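/- Let m, n ≥ 1 be integers and let A be the presented group with generators a, b, c and relations ⟨a,c⟩_{2m} = ⟨c,a⟩_{2m} and ⟨b,c⟩_{2n+1} = ⟨c,b⟩_{2n+1} (no relation between a and b). Then there is no group homomorphism ρ : A → A with ρ(a) = a, ρ(b) = b, and ρ(c) lying in the subgroup generated by a and b; that is, A admits no retraction onto the standard parabolic subgroup generated by a and b. -/

import Mathlib

/-- `altProd u v m` is the alternating product `u * v * u * v * ⋯` with `m` factors. -/
def altProd {G : Type*} [Monoid G] : G → G → ℕ → G
  | _, _, 0 => 1
  | u, v, n + 1 => u * altProd v u n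

/-- Relations of the Artin group of the triangle `(∞, 2m, 2n+1)` on generators
`a = 0`, `b = 1`, `c = 2`: `⟨a,c⟩_{2m} = ⟨c,a⟩_{2m}` and `⟨b,c⟩_{2n+1} = ⟨c,b⟩_{2n+1}`,
and no relation between `a` and `b`. -/
def triangleRels (m n : ℕ) : Set (FreeGroup (Fin 3)) :=
  { altProd (FreeGroup.of 0) (FreeGroup.of 2) (2 * m) *
      (altProd (FreeGroup.of 2) (FreeGroup.of 0) (2 * m))⁻¹,
    altProd (FreeGroup.of 1) (FreeGroup.of 2) (2 * n + 1) *
      (altProd (FreeGroup.of 2) (FreeGroup.of 1) (2 * n + 1))⁻¹ }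

theorem altProd_two_mul {G : Type*} [Monoid G] (u v : G) (m : ℕ) :
    altProd u v (2 * m) = (u * v) ^ m := by
  induction m with
  | zero => simp [altProd]
  | succ k ih =>
    rw [show 2 * (k + 1) = 2 * k + 1 + 1 by ring, altProd, altProd, ih, pow_succ', mul_assoc]

theorem altProd_two_mul_add_one {G : Type*} [Monoid G] (u v : G) (m : ℕ) :
    altProd u v (2 * m + 1) = u * (v * u) ^ m := by
  rw [altProd, altProd_two_mul]

theorem map_altProd {G H : Type*} [Monoid G] [Monoid H] (f : G →* H) (u v : G) (m : ℕ) :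
    f (altProd u v m) = altProd (f u) (f v) m := by
  induction m generalizing u v with
  | zero => exact map_one f
  | succ k ih => rw [altProd, altProd, map_mul, ih]

namespace TriangleArtin

open Matrix

/-- A parametrization of the real Heisenberg group by matrices of determinant one. -/
def heis (β s t : ℝ) : SpecialLinearGroup (Fin 3) ℝ :=
  ⟨!![1, β, 0; 0, 1, 0; s, t, 1], by simp [det_fin_three]⟩

/-- A transvection commuting with `heis 0 1 0`. -/
def transvec (x : ℝ) : SpecialLinearGroup (Fin 3) ℝ :=
  ⟨!![1, 0, 0; -x, 1, 0; 0, 0, 1], by simp [det_fin_three]⟩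

@[simp]
theorem coe_heis (β s t : ℝ) :
    (heis β s t : Matrix (Fin 3) (Fin 3) ℝ) = !![1, β, 0; 0, 1, 0; s, t, 1] := rfl

@[simp]
theorem coe_transvec (x : ℝ) :
    (transvec x : Matrix (Fin 3) (Fin 3) ℝ) = !![1, 0, 0; -x, 1, 0; 0, 0, 1] := rfl

theorem heis_mul (β s t β' s' t' : ℝ) :
    heis β s t * heis β' s' t' = heis (β + β') (s + s') (s * β' + t + t') := by
  ext i j
  fin_cases i <;> fin_cases j <;>
    (simp [Matrix.mul_apply, Fin.sum_univ_three]; try ring)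

theorem heis_zero : heis 0 0 0 = 1 := by
  ext i j
  fin_cases i <;> fin_cases j <;> simp

theorem heis_inv (β s t : ℝ) : (heis β s t)⁻¹ = heis (-β) (-s) (s * β - t) := by
  rw [inv_eq_iff_mul_eq_one, heis_mul, ← heis_zero]
  congr 1 <;> ring

theorem heis_pow (β s t : ℝ) (k : ℕ) :
    heis β s t ^ k = heis (k * β) (k * s) (k * t + s * β * (k * (k - 1) / 2)) := by
  induction k with
  | zero => simp [heis_zero]
  | succ k ih =>
    rw [pow_succ, ih, heis_mul]
    push_cast
    congr 1 <;> ring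

theorem heis_inj {β s t β' s' t' : ℝ} (h : heis β s t = heis β' s' t') :
    β = β' ∧ t = t' := by
  have h' := congrArg Subtype.val h
  exact ⟨by simpa using congrFun (congrFun h' 0) 1,
    by simpa using congrFun (congrFun h' 2) 1⟩

theorem exists_eq_heis_of_mem_closure {u : SpecialLinearGroup (Fin 3) ℝ}
    (hu : u ∈ Subgroup.closure {heis 0 1 0, heis 1 0 0}) : ∃ β s t, u = heis β s t := by
  induction hu using Subgroup.closure_induction with
  | mem x hx =>
    rcases hx with rfl | rfl
    · exact ⟨_, _, _, rfl⟩
    · exact ⟨_, _, _, rfl⟩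
  | one => exact ⟨0, 0, 0, heis_zero.symm⟩
  | mul x y _ _ hx hy =>
    obtain ⟨_, _, _, rfl⟩ := hx
    obtain ⟨_, _, _, rfl⟩ := hy
    exact ⟨_, _, _, heis_mul ..⟩
  | inv x _ hx =>
    obtain ⟨_, _, _, rfl⟩ := hx
    exact ⟨_, _, _, heis_inv ..⟩

theorem heis_transvec_comm (x : ℝ) :
    heis 0 1 0 * transvec x = transvec x * heis 0 1 0 := by
  ext i j
  fin_cases i <;> fin_cases j <;>
    simp [Matrix.mul_apply, Fin.sum_univ_three]

theorem heis_mul_transvec_pow {x : ℝ} {σ : ℕ → ℝ} (h0 : σ 0 = 0) (h1 : σ 1 = 1)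
    (h : ∀ k, σ (k + 2) = (2 - x) * σ (k + 1) - σ k) (k : ℕ) :
    ((heis 1 0 0 : Matrix (Fin 3) (Fin 3) ℝ) * transvec x) ^ k =
      !![σ (k + 1) - σ k, σ k, 0; -x * σ k, σ (k + 1) - (1 - x) * σ k, 0; 0, 0, 1] := by
  induction k with
  | zero =>
    ext i j
    fin_cases i <;> fin_cases j <;> simp [h0, h1]
  | succ k ih =>
    rw [pow_succ, ih]
    ext i j
    fin_cases i <;> fin_cases j <;>
      simp [Matrix.mul_apply, Fin.sum_univ_three, h] <;> ring

theorem heis_transvec_braid {x : ℝ} {σ : ℕ → ℝ} (h0 : σ 0 = 0) (h1 : σ 1 = 1)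
    (h : ∀ k, σ (k + 2) = (2 - x) * σ (k + 1) - σ k) {n : ℕ} (hn : σ (n + 1) = σ n) :
    (heis 1 0 0 * transvec x) ^ n * heis 1 0 0 =
      transvec x * (heis 1 0 0 * transvec x) ^ n := by
  apply Subtype.ext
  let B : Matrix (Fin 3) (Fin 3) ℝ := heis 1 0 0
  let C : Matrix (Fin 3) (Fin 3) ℝ := transvec x
  change (B * C) ^ n * B = C * (B * C) ^ n
  rw [show (B * C) ^ n = _ from heis_mul_transvec_pow h0 h1 h n, hn]
  ext i j
  fin_cases i <;> fin_cases j <;>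
    simp [B, C, Matrix.mul_apply, Fin.sum_univ_three]

theorem exists_braid {n : ℕ} (hn : 1 ≤ n) : ∃ x : ℝ,
    altProd (heis 1 0 0) (transvec x) (2 * n + 1) =
      altProd (transvec x) (heis 1 0 0) (2 * n + 1) := by
  set θ : ℝ := Real.pi / (2 * n + 1) with hθ
  have hn' : (1 : ℝ) ≤ n := by exact_mod_cast hn
  have hpos : 0 < Real.sin θ := by
    apply Real.sin_pos_of_pos_of_lt_pi
    · positivity
    · exact div_lt_self Real.pi_pos (by linarith)
  refine ⟨2 - 2 * Real.cos θ, ?_⟩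
  rw [altProd_two_mul_add_one, altProd_two_mul_add_one, ← mul_pow_mul]
  refine heis_transvec_braid (σ := fun k => Real.sin (k * θ) / Real.sin θ)
    (by simp) (by simp [hpos.ne']) (fun k => ?_) ?_
  · have h2 : ((k + 2 : ℕ) : ℝ) * θ = (k + 1) * θ + θ := by push_cast; ring
    have h3 : (k : ℝ) * θ = (k + 1) * θ - θ := by ring
    have h4 : ((k + 1 : ℕ) : ℝ) * θ = (k + 1) * θ := by push_cast; ring
    simp only [h2, h3, h4]
    rw [Real.sin_add, Real.sin_sub]
    ring
  · have h2 : ((n + 1 : ℕ) : ℝ) * θ = Real.pi - n * θ := by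
      rw [hθ]; push_cast; field_simp; ring
    simp only [h2, Real.sin_pi_sub]

theorem no_heis_solution {m n : ℕ} (hm : 1 ≤ m) (β s t : ℝ)
    (h1 : altProd (heis 0 1 0) (heis β s t) (2 * m) =
      altProd (heis β s t) (heis 0 1 0) (2 * m))
    (h2 : altProd (heis 1 0 0) (heis β s t) (2 * n + 1) =
      altProd (heis β s t) (heis 1 0 0) (2 * n + 1)) : False := by
  have hm' : (1 : ℝ) ≤ m := by exact_mod_cast hm
  rw [altProd_two_mul_add_one, altProd_two_mul_add_one] at h2
  simp only [heis_mul, heis_pow] at h2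
  have hβ : β = 1 := by linarith [(heis_inj h2).1]
  rw [altProd_two_mul, altProd_two_mul] at h1
  simp only [heis_mul, heis_pow, hβ] at h1
  nlinarith [(heis_inj h1).2]

end TriangleArtin

theorem PresentedGroup.altProd_eq_of_mem {α : Type*} {rels : Set (FreeGroup α)} {i j : α} {k : ℕ}
    (h : altProd (FreeGroup.of i) (FreeGroup.of j) k *
      (altProd (FreeGroup.of j) (FreeGroup.of i) k)⁻¹ ∈ rels) :
    altProd (PresentedGroup.of i : PresentedGroup rels) (PresentedGroup.of j) k =
      altProd (PresentedGroup.of j) (PresentedGroup.of i) k := by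
  have h' := PresentedGroup.one_of_mem h
  rwa [map_mul, map_inv, mul_inv_eq_one, map_altProd, map_altProd] at h'

/-- The Artin group of the triangle `(∞, 2m, 2n+1)` admits no retraction onto the
standard parabolic subgroup generated by `a` and `b`. -/
theorem no_retraction_inf_even_odd (m n : ℕ) (hm : 1 ≤ m) (hn : 1 ≤ n) :
    ¬ ∃ ρ : PresentedGroup (triangleRels m n) →* PresentedGroup (triangleRels m n),
        ρ (PresentedGroup.of 0) = PresentedGroup.of 0 ∧
        ρ (PresentedGroup.of 1) = PresentedGroup.of 1 ∧
        ρ (PresentedGroup.of 2) ∈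
          Subgroup.closure {PresentedGroup.of 0, PresentedGroup.of 1} := by
  rintro ⟨ρ, ha, hb, hc⟩
  obtain ⟨x, hx⟩ := TriangleArtin.exists_braid hn
  let g : Fin 3 → Matrix.SpecialLinearGroup (Fin 3) ℝ :=
    ![TriangleArtin.heis 0 1 0, TriangleArtin.heis 1 0 0, TriangleArtin.transvec x]
  have hg : ∀ r ∈ triangleRels m n, FreeGroup.lift g r = 1 := by
    rintro r (rfl | rfl)
    · simp [g, altProd_two_mul, TriangleArtin.heis_transvec_comm]
    · simp [map_altProd, g, hx]
  let φ := PresentedGroup.toGroup hg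
  have hφa : φ (PresentedGroup.of 0) = TriangleArtin.heis 0 1 0 := PresentedGroup.toGroup.of hg
  have hφb : φ (PresentedGroup.of 1) = TriangleArtin.heis 1 0 0 := PresentedGroup.toGroup.of hg
  have hw := Subgroup.mem_map_of_mem φ hc
  rw [MonoidHom.map_closure, Set.image_pair, hφa, hφb] at hw
  obtain ⟨β, s, t, hu⟩ := TriangleArtin.exists_eq_heis_of_mem_closure hw
  have h1 := congrArg (φ.comp ρ) (PresentedGroup.altProd_eq_of_mem
    (rels := triangleRels m n) (i := 0) (j := 2) (k := 2 * m) (Or.inl rfl))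
  have h2 := congrArg (φ.comp ρ) (PresentedGroup.altProd_eq_of_mem
    (rels := triangleRels m n) (i := 1) (j := 2) (k := 2 * n + 1) (Or.inr rfl))
  simp only [map_altProd, MonoidHom.comp_apply, ha, hb, hφa, hφb, hu] at h1 h2
  exact TriangleArtin.no_heis_solution hm β s t h1 h2
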